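/- arXiv:1009.4169 — 2 statements merged into one kernel-verified Lean document; each statement's English description precedes it below -/
import Mathlib

section
/- Let d ≥ 2, s > d−1, and c > 0. Let μ₁ and μ₂ be Frostman probability measures with exponent s supported on sets E₁, E₂ ⊆ [0,1]^d respectively, and assume that |x_d − y_d| ≥ c for every x in the support of μ₁ and every y in the support of μ₂ (separation in the d-th coordinate). Then the set of directions {(x−y)/‖x−y‖ : x ∈ supp μ₁, y ∈ supp μ₂} ⊆ S^{d−1} has positive (d−1)-dimensional Hausdorff measure. -/
open MeasureTheory Metric

/-- The topological support of a measure: points all of whose neighborhoods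
have positive measure. -/
def measSupport {d : ℕ} (μ : Measure (EuclideanSpace ℝ (Fin d))) :
    Set (EuclideanSpace ℝ (Fin d)) :=
  {x | ∀ ε : ℝ, 0 < ε → 0 < μ (ball x ε)}


def gcell {n : ℕ} (k : ℕ) (z : Fin n → ℤ) : Set (Fin n → ℝ) :=
  {u | ∀ i, ⌊(2:ℝ)^k * u i⌋ = z i}

lemma gcell_meas {n : ℕ} (k : ℕ) (z : Fin n → ℤ) : MeasurableSet (gcell k z) := by
  have : gcell k z = ⋂ i, (fun u : Fin n → ℝ => ⌊(2:ℝ)^k * u i⌋) ⁻¹' {z i} := by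
    ext u; simp [gcell]
  rw [this]
  refine MeasurableSet.iInter fun i => ?_
  have : Measurable (fun u : Fin n → ℝ => ⌊(2:ℝ)^k * u i⌋) := by
    apply Int.measurable_floor.comp; fun_prop
  exact this (measurableSet_singleton _)

noncomputable def gsum {n : ℕ} (ν : Measure (Fin n → ℝ)) (k : ℕ) : ENNReal :=
  ∑' z : Fin n → ℤ, ν (gcell k z) ^ 2

lemma sq_sum_enn {ι : Type*} (s : Finset ι) (f : ι → ENNReal) :
    (∑ i ∈ s, f i)^2 ≤ s.card * ∑ i ∈ s, f i ^ 2 := by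
  have := ENNReal.inner_le_Lp_mul_Lq s (fun _ => 1) f (p := 2) (q := 2) Real.HolderConjugate.two_two
  have h2 := pow_le_pow_left' this 2
  simp only [one_mul, ENNReal.one_rpow, Finset.sum_const, nsmul_eq_mul, mul_one, mul_pow,
    ← ENNReal.rpow_mul_natCast] at h2
  norm_num at h2
  exact h2

lemma gcell_child {n : ℕ} (k : ℕ) (z : Fin n → ℤ) (u : Fin n → ℝ) (hu : u ∈ gcell k z) :
    ∃ j : Fin n → Fin 2, u ∈ gcell (k+1) (fun i => 2 * z i + (j i : ℕ)) := by
  have : ∀ i, ∃ j : Fin 2, ⌊(2:ℝ)^(k+1) * u i⌋ = 2 * z i + (j : ℕ) := by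
    intro i
    have h := hu i
    rw [Int.floor_eq_iff] at h
    have e : (2:ℝ)^(k+1) * u i = 2 * (2^k * u i) := by ring
    by_cases h2 : (2:ℝ)^k * u i < z i + 1/2
    · refine ⟨0, ?_⟩
      rw [e, Int.floor_eq_iff]; push_cast; simp; constructor <;> linarith [h.1, h.2]
    · refine ⟨1, ?_⟩
      rw [e, Int.floor_eq_iff]; push_cast; simp; constructor <;> linarith [h.1, h.2]
  choose j hj using this
  exact ⟨j, hj⟩

lemma gsum_succ {n : ℕ} (ν : Measure (Fin n → ℝ)) (k : ℕ) :
    gsum ν k ≤ 2^n * gsum ν (k+1) := by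
  have h1 : ∀ z : Fin n → ℤ, ν (gcell k z)^2 ≤
      2^n * ∑ j : Fin n → Fin 2, ν (gcell (k+1) (fun i => 2 * z i + (j i : ℕ)))^2 := by
    intro z
    have : ν (gcell k z) ≤ ∑ j : Fin n → Fin 2, ν (gcell (k+1) (fun i => 2 * z i + (j i : ℕ))) := by
      refine le_trans (measure_mono ?_) (measure_iUnion_fintype_le ν _)
      intro u hu
      simpa using gcell_child k z u hu
    refine (pow_le_pow_left' this 2).trans ((sq_sum_enn _ _).trans ?_)
    simp
  calc gsum ν k ≤ ∑' z : Fin n → ℤ, 2^n * ∑ j : Fin n → Fin 2,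
        ν (gcell (k+1) (fun i => 2 * z i + (j i : ℕ)))^2 := ENNReal.tsum_le_tsum h1
    _ = 2^n * ∑' p : (Fin n → ℤ) × (Fin n → Fin 2),
        ν (gcell (k+1) (fun i => 2 * p.1 i + (p.2 i : ℕ)))^2 := by
      rw [ENNReal.tsum_mul_left, ENNReal.tsum_prod (f := fun (z : Fin n → ℤ) (j : Fin n → Fin 2) =>
        ν (gcell (k+1) (fun i => 2 * z i + ((j i : ℕ) : ℤ)))^2)]
      simp [tsum_fintype]
    _ ≤ 2^n * gsum ν (k+1) := by
      gcongr
      refine ENNReal.tsum_comp_le_tsum_of_injective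
        (f := fun p : (Fin n → ℤ) × (Fin n → Fin 2) => (fun i => 2 * p.1 i + ((p.2 i : ℕ) : ℤ))) ?_
        (fun w => ν (gcell (k+1) w)^2)
      rintro ⟨z, j⟩ ⟨z', j'⟩ h
      have h' := fun i => congrFun h i
      simp only at h'
      ext i
      · have := h' i; simp only; omega
      · have := h' i; simp only; omega

lemma two_mul_enn (a b : ENNReal) : 2 * (a * b) ≤ a^2 + b^2 := by
  by_cases ha : a = ⊤
  · simp [ha]
  by_cases hb : b = ⊤
  · simp [hb]
  lift a to NNReal using ha
  lift b to NNReal using hb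
  norm_cast
  rw [← mul_assoc]
  exact two_mul_le_add_sq a b

lemma gsum_le_prod {n : ℕ} (ν : Measure (Fin n → ℝ)) [SFinite ν] (k : ℕ) :
    gsum ν k ≤ (ν.prod ν) {p | ∀ i, |p.1 i - p.2 i| ≤ (1/2)^k} := by
  have h1 : gsum ν k = ∑' z, (ν.prod ν) (gcell k z ×ˢ gcell k z) := by
    simp [gsum, Measure.prod_prod, sq]
  rw [h1, ← measure_iUnion]
  · apply measure_mono
    intro p hp
    simp only [Set.mem_iUnion] at hp
    obtain ⟨z, hz1, hz2⟩ := hp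
    intro i
    have a := hz1 i
    have b := hz2 i
    rw [← b] at a
    have := Int.abs_sub_lt_one_of_floor_eq_floor a
    rw [← mul_sub, abs_mul, abs_of_pos (by positivity)] at this
    rw [one_div, inv_pow, ← one_div, le_div_iff₀ (by positivity)]
    linarith
  · intro z w hzw
    rw [Function.onFun, Set.disjoint_left]
    rintro p ⟨h, -⟩ ⟨h', -⟩
    apply hzw
    ext i
    rw [← h i, ← h' i]
  · intro z; exact (gcell_meas k z).prod (gcell_meas k z)

lemma prod_le_gsum {n : ℕ} (ν ν₁ ν₂ : Measure (Fin n → ℝ)) [SFinite ν₁] [SFinite ν₂]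
    (h₁ : ν₁ ≤ ν) (h₂ : ν₂ ≤ ν) (k : ℕ) :
    (ν₁.prod ν₂) {p | ∀ i, |p.1 i - p.2 i| ≤ (1/2)^k} ≤ 3^n * gsum ν k := by
  have hsub : {p : (Fin n → ℝ) × (Fin n → ℝ) | ∀ i, |p.1 i - p.2 i| ≤ (1/2)^k} ⊆
      ⋃ j : Fin n → Fin 3, ⋃ z : Fin n → ℤ,
        gcell k z ×ˢ gcell k (fun i => z i + ((j i : ℕ) : ℤ) - 1) := by
    intro p hp
    have : ∀ i, ∃ j : Fin 3, ⌊(2:ℝ)^k * p.2 i⌋ = ⌊(2:ℝ)^k * p.1 i⌋ + ((j : ℕ) : ℤ) - 1 := by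
      intro i
      have h := hp i
      rw [one_div, inv_pow, ← one_div, le_div_iff₀ (by positivity)] at h
      have h' : |(2:ℝ)^k * p.1 i - 2^k * p.2 i| ≤ 1 := by
        rw [← mul_sub, abs_mul, abs_of_pos (by positivity)]; linarith
      rw [abs_le] at h'
      have a1 : ⌊(2:ℝ)^k * p.2 i⌋ ≤ ⌊(2:ℝ)^k * p.1 i⌋ + 1 := by
        rw [← Int.floor_add_one]; apply Int.floor_le_floor; linarith
      have a2 : ⌊(2:ℝ)^k * p.1 i⌋ ≤ ⌊(2:ℝ)^k * p.2 i⌋ + 1 := by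
        rw [← Int.floor_add_one]; apply Int.floor_le_floor; linarith
      refine ⟨⟨(⌊(2:ℝ)^k * p.2 i⌋ + 1 - ⌊(2:ℝ)^k * p.1 i⌋).toNat, by omega⟩, ?_⟩
      simp only; omega
    choose j hj using this
    simp only [Set.mem_iUnion]
    exact ⟨j, fun i => ⌊(2:ℝ)^k * p.1 i⌋, fun i => rfl, hj⟩
  refine (measure_mono hsub).trans ((measure_iUnion_fintype_le _ _).trans ?_)
  have key : ∀ j : Fin n → Fin 3, (ν₁.prod ν₂) (⋃ z : Fin n → ℤ,
        gcell k z ×ˢ gcell k (fun i => z i + ((j i : ℕ) : ℤ) - 1)) ≤ gsum ν k := by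
    intro j
    refine (measure_iUnion_le _).trans ?_
    have : 2 * ∑' z : Fin n → ℤ, (ν₁.prod ν₂) (gcell k z ×ˢ gcell k (fun i => z i + ((j i : ℕ) : ℤ) - 1))
        ≤ 2 * gsum ν k := by
      rw [← ENNReal.tsum_mul_left]
      calc _ ≤ ∑' z : Fin n → ℤ, (ν (gcell k z)^2 + ν (gcell k (fun i => z i + ((j i : ℕ) : ℤ) - 1))^2) := by
            apply ENNReal.tsum_le_tsum
            intro z
            rw [Measure.prod_prod]
            refine le_trans ?_ (two_mul_enn _ _)
            gcongr
        _ ≤ gsum ν k + gsum ν k := by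
            rw [ENNReal.tsum_add]
            refine add_le_add le_rfl ?_
            · refine ENNReal.tsum_comp_le_tsum_of_injective
                (f := fun z : Fin n → ℤ => (fun i => z i + ((j i : ℕ) : ℤ) - 1)) ?_
                (fun w => ν (gcell k w)^2)
              intro z w h
              ext i
              have := congrFun h i
              simp only at this
              omega
        _ = _ := by rw [two_mul]
    exact (ENNReal.mul_le_mul_iff_right (by simp) (by simp)).1 this
  refine (Finset.sum_le_sum (fun j _ => key j)).trans ?_
  simp

def prj {n : ℕ} (t : Fin n → ℝ) (x : EuclideanSpace ℝ (Fin (n+1))) : Fin n → ℝ :=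
  fun i => x i.castSucc - t i * x (Fin.last n)

lemma norm_le_coord {m : ℕ} (w : EuclideanSpace ℝ (Fin m)) (B : ℝ) (hB : 0 ≤ B)
    (h : ∀ i, |w i| ≤ B) : ‖w‖ ≤ m * B := by
  rw [EuclideanSpace.norm_eq]
  rw [Real.sqrt_le_iff]
  refine ⟨by positivity, ?_⟩
  calc ∑ i, ‖w i‖^2 ≤ ∑ i : Fin m, B^2 := by
        apply Finset.sum_le_sum; intro i _
        exact pow_le_pow_left₀ (norm_nonneg _) (h i) 2
    _ = m * B^2 := by simp
    _ ≤ (m * B)^2 := by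
      rw [mul_pow]
      gcongr
      rcases Nat.eq_zero_or_pos m with h0 | h0
      · simp [h0]
      · have : (1:ℝ) ≤ m := by exact_mod_cast h0
        nlinarith

lemma vol_bound {n : ℕ} (R r : ℝ) (hR : 1 ≤ R) (hr : 0 < r)
    (w : EuclideanSpace ℝ (Fin (n+1))) (hw : w ≠ 0) :
    volume (closedBall (0 : Fin n → ℝ) R ∩ {t | ∀ i, |prj t w i| ≤ r}) ≤
      ENNReal.ofReal ((4 * R * (n+1) * r * ‖w‖⁻¹)^n) := by
  have hw0 : 0 < ‖w‖ := norm_pos_iff.2 hw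
  by_cases hne : (closedBall (0 : Fin n → ℝ) R ∩ {t | ∀ i, |prj t w i| ≤ r}).Nonempty
  swap
  · rw [Set.not_nonempty_iff_eq_empty.1 hne]; simp
  obtain ⟨t, ht, ht'⟩ := hne
  set l := w (Fin.last n) with hl
  have hc : ∀ i, |w i| ≤ r + R * |l| := by
    intro i
    refine Fin.lastCases ?_ (fun i => ?_) i
    · rw [← hl]; nlinarith [abs_nonneg l]
    · have h1 := ht' i
      have h2 : |t i| ≤ R := by
        have := norm_le_pi_norm t i
        rw [mem_closedBall_zero_iff] at ht
        exact this.trans ht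
      have h3 : w i.castSucc = prj t w i + t i * l := by simp [prj, hl]
      rw [h3]
      refine (abs_add_le _ _).trans ?_
      rw [abs_mul]
      gcongr
  have hN := norm_le_coord w _ (by positivity) hc
  push_cast at hN
  by_cases h : ‖w‖ ≤ 2 * R * (n+1) * |l|
  · have hl0 : 0 < |l| := by
      by_contra hcon
      have : |l| = 0 := le_antisymm (not_lt.1 hcon) (abs_nonneg _)
      rw [this] at h; linarith
    have hsub : (closedBall (0 : Fin n → ℝ) R ∩ {t | ∀ i, |prj t w i| ≤ r}) ⊆
        closedBall (fun i => w i.castSucc / l) (r / |l|) := by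
      rintro t ⟨-, ht⟩
      rw [mem_closedBall, dist_pi_le_iff (by positivity)]
      intro i
      rw [Real.dist_eq, abs_sub_comm, le_div_iff₀ hl0, ← abs_mul]
      have := ht i
      have e : (w i.castSucc / l - t i) * l = prj t w i := by
        have : l ≠ 0 := abs_pos.1 hl0
        simp only [prj, ← hl]
        field_simp
      rw [e]
      exact this
    refine (measure_mono hsub).trans ?_
    rw [Real.volume_pi_closedBall _ (by positivity), Fintype.card_fin]
    apply ENNReal.ofReal_le_ofReal
    apply pow_le_pow_left₀ (by positivity)
    rw [← div_eq_mul_inv, le_div_iff₀ hw0, mul_div_assoc', div_mul_eq_mul_div, div_le_iff₀ hl0]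
    nlinarith
  · refine (measure_mono Set.inter_subset_left).trans ?_
    rw [Real.volume_pi_closedBall _ (by positivity), Fintype.card_fin]
    apply ENNReal.ofReal_le_ofReal
    apply pow_le_pow_left₀ (by positivity)
    rw [← div_eq_mul_inv, le_div_iff₀ hw0]
    have : ‖w‖ ≤ 2 * (n+1) * r := by
      push Not at h
      nlinarith
    nlinarith

noncomputable def ker {n : ℕ}
    (p : EuclideanSpace ℝ (Fin (n+1)) × EuclideanSpace ℝ (Fin (n+1))) : ENNReal :=
  1 + ∑' j : ℕ, (2^n)^(j+1) * {q : EuclideanSpace ℝ (Fin (n+1)) × EuclideanSpace ℝ (Fin (n+1)) |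
    dist q.2 q.1 < 2 * (1/2)^j}.indicator (fun _ => (1 : ENNReal)) p

lemma ker_set_meas {n : ℕ} (j : ℕ) : MeasurableSet
    {q : EuclideanSpace ℝ (Fin (n+1)) × EuclideanSpace ℝ (Fin (n+1)) |
    dist q.2 q.1 < 2 * (1/2)^j} := by
  apply IsOpen.measurableSet
  exact isOpen_lt (by fun_prop) (by fun_prop)

lemma ker_meas {n : ℕ} : Measurable (ker (n := n)) := by
  unfold ker
  refine measurable_const.add (Measurable.ennreal_tsum fun j => ?_)
  exact measurable_const.mul (measurable_const.indicator (ker_set_meas j))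

lemma ker_diag {n : ℕ} (x : EuclideanSpace ℝ (Fin (n+1))) : ker (x, x) = ⊤ := by
  unfold ker
  rw [ENNReal.add_eq_top]; right
  rw [eq_top_iff, ← ENNReal.tsum_const_eq_top_of_ne_zero (α := ℕ) (one_ne_zero)]
  apply ENNReal.tsum_le_tsum
  intro j
  rw [Set.indicator_of_mem (by simp)]
  simp only [mul_one]
  exact one_le_pow₀ (one_le_pow₀ (by norm_num))

lemma le_ker {n : ℕ} (x y : EuclideanSpace ℝ (Fin (n+1))) (h : x ≠ y) :
    ENNReal.ofReal ((‖x - y‖⁻¹)^n) ≤ ker (x, y) := by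
  have h0 : 0 < ‖x - y‖ := norm_pos_iff.2 (sub_ne_zero.2 h)
  by_cases h1 : 1 ≤ ‖x - y‖
  · refine le_trans ?_ (le_self_add)
    rw [← ENNReal.ofReal_one]
    apply ENNReal.ofReal_le_ofReal
    exact pow_le_one₀ (by positivity) (inv_le_one_of_one_le₀ h1)
  · obtain ⟨j, hj1, hj2⟩ := exists_nat_pow_near_of_lt_one h0 (not_le.1 h1).le
      (y := (1/2:ℝ)) (by norm_num) (by norm_num)
    refine le_trans ?_ (le_add_self)
    refine le_trans ?_ (ENNReal.le_tsum j)
    rw [Set.indicator_of_mem]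
    · simp only [mul_one]
      have : ((2:ENNReal)^n)^(j+1) = ENNReal.ofReal (((2:ℝ)^n)^(j+1)) := by
        rw [ENNReal.ofReal_pow (by positivity), ENNReal.ofReal_pow (by positivity)]; simp
      rw [this]
      apply ENNReal.ofReal_le_ofReal
      rw [← pow_mul, mul_comm, pow_mul]
      apply pow_le_pow_left₀ (by positivity)
      rw [inv_le_comm₀ h0 (by positivity), ← inv_pow]
      rw [one_div] at hj1; exact hj1.le
    · simp only [Set.mem_ofPred_eq, ]
      rw [dist_comm, dist_eq_norm]
      have : (0:ℝ) < (1/2)^j := by positivity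
      linarith

lemma ker_int {n : ℕ} (s C : ℝ) (hs : n < s) (hC : 0 < C)
    (μ : Measure (EuclideanSpace ℝ (Fin (n+1)))) [IsFiniteMeasure μ]
    (hfrost : ∀ x r, 0 < r → μ (ball x r) ≤ ENNReal.ofReal (C * r ^ s)) :
    ∫⁻ p, ker p ∂(μ.prod μ) < ⊤ := by
  set B : ENNReal := μ Set.univ + ∑' j : ℕ, (2^n)^(j+1) * ENNReal.ofReal (C * (2 * (1/2)^j)^s) with hB
  have hBfin : B < ⊤ := by
    refine ENNReal.add_lt_top.2 ⟨measure_lt_top _ _, ?_⟩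
    have e : ∀ j : ℕ, ((2:ENNReal)^n)^(j+1) * ENNReal.ofReal (C * (2 * (1/2)^j)^s) =
        ENNReal.ofReal ((2^n * C * 2^s) * (2^((n:ℝ)-s))^j) := by
      intro j
      have : ((2:ENNReal)^n)^(j+1) = ENNReal.ofReal (((2:ℝ)^n)^(j+1)) := by
        rw [ENNReal.ofReal_pow (by positivity), ENNReal.ofReal_pow (by positivity)]; simp
      rw [this, ← ENNReal.ofReal_mul (by positivity)]
      congr 1
      rw [Real.mul_rpow (by positivity) (by positivity), Real.rpow_sub (by norm_num),
        Real.rpow_natCast, one_div, inv_pow, Real.inv_rpow (by positivity), ← Real.rpow_natCast_mul (by positivity),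
        mul_comm (j:ℝ) s, Real.rpow_mul_natCast (by positivity)]
      rw [div_pow]
      field_simp
      exact pow_succ' _ _
    simp_rw [e]
    have hlt : (2:ℝ)^((n:ℝ)-s) < 1 := Real.rpow_lt_one_of_one_lt_of_neg (by norm_num) (by linarith)
    rw [← ENNReal.ofReal_tsum_of_nonneg]
    · exact ENNReal.ofReal_lt_top
    · intro j; positivity
    · exact (summable_geometric_of_lt_one (by positivity) hlt).mul_left _
  rw [lintegral_prod _ ker_meas.aemeasurable]
  have : ∀ x, ∫⁻ y, ker (x, y) ∂μ ≤ B := by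
    intro x
    unfold ker
    rw [lintegral_add_left measurable_const, lintegral_one, hB]
    gcongr
    have hm : ∀ j : ℕ, Measurable fun y : EuclideanSpace ℝ (Fin (n+1)) =>
        {q : EuclideanSpace ℝ (Fin (n+1)) × EuclideanSpace ℝ (Fin (n+1)) |
            dist q.2 q.1 < 2 * (1/2)^j}.indicator (fun _ => (1 : ENNReal)) (x, y) := fun j =>
      (measurable_const.indicator (ker_set_meas j)).comp measurable_prodMk_left
    rw [lintegral_tsum (fun j => ((hm j).const_mul _).aemeasurable)]
    gcongr with j
    rw [lintegral_const_mul _ (hm j)]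
    gcongr
    have : (fun y : EuclideanSpace ℝ (Fin (n+1)) =>
        {q : EuclideanSpace ℝ (Fin (n+1)) × EuclideanSpace ℝ (Fin (n+1)) |
            dist q.2 q.1 < 2 * (1/2)^j}.indicator (fun _ => (1 : ENNReal)) (x, y)) =
        (ball x (2 * (1/2)^j)).indicator 1 := by
      ext y; simp only [Set.indicator, mem_ball, Pi.one_apply]; rfl
    rw [this, lintegral_indicator_one measurableSet_ball]
    exact hfrost _ _ (by positivity)
  refine (lintegral_mono this).trans_lt ?_
  simp [ENNReal.mul_lt_top_iff, hBfin]

lemma prj_cont {n : ℕ} : Continuous (fun q : (Fin n → ℝ) × EuclideanSpace ℝ (Fin (n+1)) =>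
    prj q.1 q.2) := by
  unfold prj; fun_prop

lemma prj_meas {n : ℕ} (t : Fin n → ℝ) : Measurable (prj t) :=
  (prj_cont.comp (Continuous.prodMk_right t)).measurable

/-- triples `(t, x, y)` with nearby projections -/
def near (n k : ℕ) :
    Set ((Fin n → ℝ) × (EuclideanSpace ℝ (Fin (n+1)) × EuclideanSpace ℝ (Fin (n+1)))) :=
  {q | ∀ i, |prj q.1 q.2.1 i - prj q.1 q.2.2 i| ≤ (1/2)^k}

lemma near_meas (n k : ℕ) : MeasurableSet (near n k) := by
  apply IsClosed.measurableSet
  unfold near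
  rw [Set.ofPred_forall]
  refine isClosed_iInter fun i => isClosed_le ?_ continuous_const
  unfold prj; fun_prop

lemma near_prod {n : ℕ} (k : ℕ) (t : Fin n → ℝ)
    (μ ν : Measure (EuclideanSpace ℝ (Fin (n+1)))) [SFinite μ] [SFinite ν] :
    ((μ.map (prj t)).prod (ν.map (prj t))) {p | ∀ i, |p.1 i - p.2 i| ≤ (1/2)^k} =
      (μ.prod ν) (Prod.mk t ⁻¹' near n k) := by
  rw [Measure.map_prod_map _ _ (prj_meas t) (prj_meas t), Measure.map_apply]
  · rfl
  · exact ((prj_meas t).comp measurable_fst).prodMk ((prj_meas t).comp measurable_snd)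
  · apply IsClosed.measurableSet
    rw [Set.ofPred_forall]
    refine isClosed_iInter fun i => isClosed_le (by fun_prop) continuous_const

lemma prj_sub {n : ℕ} (t : Fin n → ℝ) (x y : EuclideanSpace ℝ (Fin (n+1))) (i : Fin n) :
    prj t (x - y) i = prj t x i - prj t y i := by
  simp [prj]; ring

lemma energy_bound {n : ℕ} (s C R : ℝ) (hs : n < s) (hC : 0 < C) (hR : 1 ≤ R)
    (μ : Measure (EuclideanSpace ℝ (Fin (n+1)))) [IsFiniteMeasure μ]
    (hfrost : ∀ x r, 0 < r → μ (ball x r) ≤ ENNReal.ofReal (C * r ^ s)) :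
    ∃ B : ENNReal, B < ⊤ ∧ ∀ k : ℕ,
      ∫⁻ t in closedBall (0 : Fin n → ℝ) R, (2^n)^k * gsum (μ.map (prj t)) k ≤ B := by
  refine ⟨ENNReal.ofReal ((4 * R * (n+1))^n) * ∫⁻ p, ker p ∂(μ.prod μ),
    ENNReal.mul_lt_top ENNReal.ofReal_lt_top (ker_int s C hs hC μ hfrost), fun k => ?_⟩
  have hpw : ∀ p : EuclideanSpace ℝ (Fin (n+1)) × EuclideanSpace ℝ (Fin (n+1)),
      (2^n)^k * (volume.restrict (closedBall (0 : Fin n → ℝ) R)) ((fun t => (t, p)) ⁻¹' near n k) ≤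
       ENNReal.ofReal ((4 * R * (n+1))^n) * ker p := by
    rintro ⟨x, y⟩
    by_cases hxy : x = y
    · rw [hxy, ker_diag, ENNReal.mul_top]
      · exact le_top
      · simp; positivity
    · rw [Measure.restrict_apply (measurable_prodMk_right (near_meas n k)), Set.inter_comm]
      have e : (fun t : Fin n → ℝ => (t, (x, y))) ⁻¹' near n k =
          {t | ∀ i, |prj t (x - y) i| ≤ (1/2)^k} := by
        ext t; simp [near, prj_sub]
      rw [e]
      have h1 := vol_bound R ((1/2)^k) hR (by positivity) (x - y) (sub_ne_zero.2 hxy)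
      have h2 := le_ker x y hxy
      refine (mul_le_mul_right h1 _).trans (le_trans (le_of_eq ?_) (mul_le_mul_right h2 _))
      have : ((2:ENNReal)^n)^k = ENNReal.ofReal (((2:ℝ)^n)^k) := by
        rw [ENNReal.ofReal_pow (by positivity), ENNReal.ofReal_pow (by positivity)]; simp
      rw [this, ← ENNReal.ofReal_mul (by positivity), ← ENNReal.ofReal_mul (by positivity)]
      congr 1
      rw [← pow_mul, mul_comm n k, pow_mul, ← mul_pow, ← mul_pow]
      congr 1
      rw [one_div, inv_pow]
      field_simp
  calc ∫⁻ t in closedBall (0 : Fin n → ℝ) R, (2^n)^k * gsum (μ.map (prj t)) k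
      ≤ ∫⁻ t in closedBall (0 : Fin n → ℝ) R, (2^n)^k * (μ.prod μ) (Prod.mk t ⁻¹' near n k) := by
        gcongr with t
        rw [← near_prod]
        exact gsum_le_prod _ _
    _ = (2^n)^k * ((volume.restrict (closedBall (0 : Fin n → ℝ) R)).prod (μ.prod μ)) (near n k) := by
        rw [lintegral_const_mul _ (measurable_measure_prodMk_left (near_meas n k)),
          Measure.prod_apply (near_meas n k)]
    _ = ∫⁻ p, (2^n)^k * (volume.restrict (closedBall (0 : Fin n → ℝ) R)) ((fun t => (t, p)) ⁻¹' near n k) ∂(μ.prod μ) := by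
        rw [lintegral_const_mul _ (measurable_measure_prodMk_right (near_meas n k)),
          Measure.prod_apply_symm (near_meas n k)]
    _ ≤ _ := by
        rw [← lintegral_const_mul _ ker_meas]
        exact lintegral_mono hpw

noncomputable def slp {n : ℕ} (p : EuclideanSpace ℝ (Fin (n+1)) × EuclideanSpace ℝ (Fin (n+1))) :
    Fin n → ℝ :=
  fun i => (p.1 i.castSucc - p.2 i.castSucc) / (p.1 (Fin.last n) - p.2 (Fin.last n))

lemma gsum_meas {n : ℕ} (k : ℕ) (μ : Measure (EuclideanSpace ℝ (Fin (n+1)))) [SFinite μ] :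
    Measurable fun t : Fin n → ℝ => gsum (μ.map (prj t)) k := by
  unfold gsum
  refine Measurable.ennreal_tsum fun z => ?_
  apply Measurable.pow_const
  have e : (fun t : Fin n → ℝ => (μ.map (prj t)) (gcell k z)) = fun t => μ (Prod.mk t ⁻¹'
      ((fun q : (Fin n → ℝ) × EuclideanSpace ℝ (Fin (n+1)) => prj q.1 q.2) ⁻¹' (gcell k z))) := by
    ext t
    rw [Measure.map_apply (prj_meas t) (gcell_meas k z)]
    rfl
  rw [e]
  exact measurable_measure_prodMk_left (prj_cont.measurable (gcell_meas k z))

lemma core {n : ℕ} (s C R₀ : ℝ) (hs : n < s) (hC : 0 < C) (hR₀ : 0 ≤ R₀)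
    (μ₁ μ₂ : Measure (EuclideanSpace ℝ (Fin (n+1))))
    [IsProbabilityMeasure μ₁] [IsProbabilityMeasure μ₂]
    (hf₁ : ∀ x r, 0 < r → μ₁ (ball x r) ≤ ENNReal.ofReal (C * r ^ s))
    (hf₂ : ∀ x r, 0 < r → μ₂ (ball x r) ≤ ENNReal.ofReal (C * r ^ s))
    (S₁ S₂ : Set (EuclideanSpace ℝ (Fin (n+1)))) (hS₁ : μ₁ S₁ᶜ = 0) (hS₂ : μ₂ S₂ᶜ = 0)
    (D : Set (Fin n → ℝ)) (hD : IsCompact D) (hDR : D ⊆ closedBall 0 R₀)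
    (h0 : ∀ x ∈ S₁, ∀ y ∈ S₂, x (Fin.last n) - y (Fin.last n) ≠ 0)
    (h1 : ∀ x ∈ S₁, ∀ y ∈ S₂, |x (Fin.last n) - y (Fin.last n)| ≤ 1)
    (h2 : ∀ x ∈ S₁, ∀ y ∈ S₂, slp (x, y) ∈ D) (hvol : volume D = 0) : False := by
  set μ := μ₁ + μ₂ with hμ
  have hf : ∀ x r, 0 < r → μ (ball x r) ≤ ENNReal.ofReal ((2 * C) * r ^ s) := by
    intro x r hr
    rw [hμ, Measure.add_apply, mul_assoc, two_mul, ENNReal.ofReal_add (by positivity) (by positivity)]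
    exact add_le_add (hf₁ x r hr) (hf₂ x r hr)
  set R := R₀ + 1 with hR
  obtain ⟨B, hB, hE⟩ := energy_bound s (2 * C) R hs (by positivity) (by linarith) μ hf
  set g : (Fin n → ℝ) → ENNReal := fun t => ⨆ k : ℕ, (2^n)^k * gsum (μ.map (prj t)) k with hg
  have hmk : ∀ k : ℕ, Measurable fun t : Fin n → ℝ => (2^n)^k * gsum (μ.map (prj t)) k :=
    fun k => (gsum_meas k μ).const_mul _
  have hgi : ∫⁻ t in closedBall (0 : Fin n → ℝ) R, g t ≤ B := by
    rw [hg, lintegral_iSup hmk]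
    · exact iSup_le hE
    · apply monotone_nat_of_le_succ
      intro k t
      simp only
      rw [pow_succ, mul_assoc]
      gcongr
      exact gsum_succ _ _
  set ρ := (volume.restrict (closedBall (0 : Fin n → ℝ) R)).withDensity g with hρ
  have hρfin : ∀ A, ρ A ≠ ⊤ := by
    intro A
    refine ((measure_mono (Set.subset_univ A)).trans_lt ?_).ne
    rw [hρ, withDensity_apply _ MeasurableSet.univ, Measure.restrict_univ]
    exact hgi.trans_lt hB
  have hρD : ρ D = 0 := by
    apply withDensity_absolutelyContinuous
    exact le_antisymm ((Measure.restrict_apply_le _ _).trans hvol.le) bot_le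
  have hlim := tendsto_measure_cthickening_of_isClosed (μ := ρ) ⟨1, one_pos, hρfin _⟩ hD.isClosed
  rw [hρD] at hlim
  have hpow : Filter.Tendsto (fun k : ℕ => (1/2:ℝ)^k) Filter.atTop (nhds 0) :=
    tendsto_pow_atTop_nhds_zero_of_lt_one (by norm_num) (by norm_num)
  have hlim2 := ENNReal.Tendsto.const_mul (a := 3^n) (hlim.comp hpow) (Or.inr (by finiteness))
  rw [mul_zero] at hlim2
  have hae : ∀ᵐ p ∂(μ₁.prod μ₂), p.1 ∈ S₁ ∧ p.2 ∈ S₂ := by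
    have a1 : ∀ᵐ x ∂μ₁, x ∈ S₁ := hS₁
    have a2 : ∀ᵐ x ∂μ₂, x ∈ S₂ := hS₂
    filter_upwards [Measure.quasiMeasurePreserving_fst.ae a1,
      Measure.quasiMeasurePreserving_snd.ae a2] with p b1 b2 using ⟨b1, b2⟩
  have hkey : ∀ k : ℕ, (2:ENNReal)^n ≤ 3^n * ρ (cthickening ((1/2)^k) D) := by
    intro k
    set T := cthickening ((1/2:ℝ)^k) D with hT
    have hTm : MeasurableSet T := isClosed_cthickening.measurableSet
    have hTR : T ⊆ closedBall 0 R := by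
      refine (cthickening_subset_of_subset _ hDR).trans ?_
      refine (cthickening_mono (pow_le_one₀ (by norm_num) (by norm_num)) _).trans ?_
      rw [cthickening_closedBall zero_le_one hR₀, add_comm]
    have hpt : ∀ᵐ p ∂(μ₁.prod μ₂), ENNReal.ofReal ((2 * (1/2)^k)^n) ≤
        (volume.restrict T) ((fun t => (t, p)) ⁻¹' near n k) := by
      filter_upwards [hae] with p hp
      have := Real.volume_pi_closedBall (slp p) (r := (1/2)^k) (by positivity)
      rw [Fintype.card_fin] at this
      rw [← this, Measure.restrict_apply (measurable_prodMk_right (near_meas n k))]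
      apply measure_mono
      intro t ht
      refine ⟨?_, ?_⟩
      · intro i
        simp only
        rw [← prj_sub]
        have h0' := h0 _ hp.1 _ hp.2
        have h1' := h1 _ hp.1 _ hp.2
        have e : prj t (p.1 - p.2) i = (slp p i - t i) * (p.1 (Fin.last n) - p.2 (Fin.last n)) := by
          simp only [prj, slp, PiLp.sub_apply]
          field_simp
        rw [e, abs_mul]
        rw [mem_closedBall, dist_pi_le_iff (by positivity)] at ht
        have := ht i
        rw [Real.dist_eq, abs_sub_comm] at this
        calc _ ≤ (1/2:ℝ)^k * 1 := by gcongr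
          _ = _ := mul_one _
      · exact closedBall_subset_cthickening (h2 _ hp.1 _ hp.2) _ ht
    have hint : ENNReal.ofReal ((2 * (1/2)^k)^n) ≤ ∫⁻ t in T, 3^n * gsum (μ.map (prj t)) k := by
      calc ENNReal.ofReal ((2 * (1/2)^k)^n) = ∫⁻ p, ENNReal.ofReal ((2 * (1/2)^k)^n) ∂(μ₁.prod μ₂) := by simp
        _ ≤ ∫⁻ p, (volume.restrict T) ((fun t => (t, p)) ⁻¹' near n k) ∂(μ₁.prod μ₂) :=
          lintegral_mono_ae hpt
        _ = ∫⁻ t in T, (μ₁.prod μ₂) (Prod.mk t ⁻¹' near n k) := by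
          rw [← Measure.prod_apply_symm (near_meas n k), Measure.prod_apply (near_meas n k)]
        _ ≤ _ := by
          gcongr with t
          rw [← near_prod]
          apply prod_le_gsum
          · exact Measure.map_mono (Measure.le_add_right le_rfl) (prj_meas t)
          · exact Measure.map_mono (Measure.le_add_left le_rfl) (prj_meas t)
    have e2 : (2:ENNReal)^n = (2^n)^k * ENNReal.ofReal ((2 * (1/2)^k)^n) := by
      have : ((2:ENNReal)^n)^k = ENNReal.ofReal (((2:ℝ)^n)^k) := by
        rw [ENNReal.ofReal_pow (by positivity), ENNReal.ofReal_pow (by positivity)]; simp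
      rw [this, ← ENNReal.ofReal_mul (by positivity), ← pow_mul, mul_comm n k, pow_mul, ← mul_pow]
      have : (2:ℝ)^k * (2 * (1/2)^k) = 2 := by
        rw [one_div, inv_pow]; field_simp
      rw [this, ENNReal.ofReal_pow (by positivity)]; simp
    calc (2:ENNReal)^n = (2^n)^k * ENNReal.ofReal ((2 * (1/2)^k)^n) := e2
      _ ≤ (2^n)^k * ∫⁻ t in T, 3^n * gsum (μ.map (prj t)) k := by gcongr
      _ = 3^n * ∫⁻ t in T, (2^n)^k * gsum (μ.map (prj t)) k := by
        rw [lintegral_const_mul _ (gsum_meas k μ), lintegral_const_mul _ (gsum_meas k μ)]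
        ring
      _ ≤ 3^n * ∫⁻ t in T, g t := by
        gcongr with t
        exact le_iSup (fun k : ℕ => (2^n)^k * gsum (μ.map (prj t)) k) k
      _ = 3^n * ρ T := by
        rw [hρ, withDensity_apply _ hTm, Measure.restrict_restrict hTm,
          Set.inter_eq_left.2 hTR]
  have := ge_of_tendsto' hlim2 hkey
  simp at this

lemma supp_null {d : ℕ} (μ : Measure (EuclideanSpace ℝ (Fin d))) : μ (measSupport μ)ᶜ = 0 := by
  apply measure_null_of_locally_null
  intro x hx
  simp only [measSupport, Set.mem_compl_iff, Set.mem_ofPred_eq, not_forall, not_lt] at hx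
  obtain ⟨ε, hε, h⟩ := hx
  exact ⟨ball x ε, mem_nhdsWithin_of_mem_nhds (ball_mem_nhds x hε), le_antisymm h bot_le⟩

lemma supp_closed {d : ℕ} (μ : Measure (EuclideanSpace ℝ (Fin d))) : IsClosed (measSupport μ) := by
  rw [← isOpen_compl_iff, Metric.isOpen_iff]
  intro x hx
  simp only [measSupport, Set.mem_compl_iff, Set.mem_ofPred_eq, not_forall, not_lt] at hx
  obtain ⟨ε, hε, h⟩ := hx
  refine ⟨ε/2, by positivity, fun y hy hcon => ?_⟩
  have := hcon (ε/2) (by positivity)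
  refine absurd (this.trans_le ((measure_mono ?_).trans h)) (lt_irrefl _)
  apply ball_subset_ball'
  rw [mem_ball] at hy
  linarith

lemma supp_compact {d : ℕ} (μ : Measure (EuclideanSpace ℝ (Fin d)))
    (h : ∀ x ∈ measSupport μ, ∀ i, x i ∈ Set.Icc (0 : ℝ) 1) : IsCompact (measSupport μ) := by
  refine (isCompact_closedBall (0 : EuclideanSpace ℝ (Fin d)) (d * 1)).of_isClosed_subset
    (supp_closed μ) ?_
  intro x hx
  rw [mem_closedBall_zero_iff]
  apply norm_le_coord _ _ zero_le_one
  intro i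
  rw [abs_of_nonneg (h x hx i).1]
  exact (h x hx i).2

noncomputable def gno {n : ℕ} (ω : EuclideanSpace ℝ (Fin (n+1))) : Fin n → ℝ :=
  fun i => ω i.castSucc / ω (Fin.last n)

lemma gno_lip {n : ℕ} (c : ℝ) (hc : 0 < c) :
    LipschitzOnWith (Real.toNNReal (1/c + 1/c^2)) (gno (n := n))
      {ω | ‖ω‖ ≤ 1 ∧ c ≤ |ω (Fin.last n)|} := by
  apply LipschitzOnWith.of_dist_le_mul
  rintro x ⟨hx1, hx2⟩ y ⟨hy1, hy2⟩
  rw [Real.coe_toNNReal _ (by positivity), dist_pi_le_iff (by positivity)]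
  intro i
  have hx0 : x (Fin.last n) ≠ 0 := abs_pos.1 (hc.trans_le hx2)
  have hy0 : y (Fin.last n) ≠ 0 := abs_pos.1 (hc.trans_le hy2)
  have hd : ∀ j, |x j - y j| ≤ dist x y := by
    intro j
    rw [dist_eq_norm]
    exact PiLp.norm_apply_le (x - y) j
  have hyi : |y i.castSucc| ≤ 1 := (PiLp.norm_apply_le y _).trans hy1
  have e : gno x i - gno y i = (x i.castSucc - y i.castSucc) / x (Fin.last n) +
      y i.castSucc * (y (Fin.last n) - x (Fin.last n)) / (x (Fin.last n) * y (Fin.last n)) := by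
    simp only [gno]; field_simp; ring
  rw [Real.dist_eq, e, add_mul]
  refine (abs_add_le _ _).trans (add_le_add ?_ ?_)
  · rw [abs_div, one_div_mul_eq_div]
    gcongr
    exact hd _
  · rw [abs_div, abs_mul, abs_mul, one_div_mul_eq_div, abs_sub_comm, sq]
    gcongr
    calc _ ≤ 1 * dist x y := by gcongr; exact hd _
      _ = _ := one_mul _

theorem directions_of_separated_frostman_pair (d : ℕ) (hd : 2 ≤ d)
    (s : ℝ) (hs : (d : ℝ) - 1 < s) (c : ℝ) (hc : 0 < c)
    (E₁ E₂ : Set (EuclideanSpace ℝ (Fin d)))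
    (hE₁ : E₁ ⊆ {x : EuclideanSpace ℝ (Fin d) | ∀ i, x i ∈ Set.Icc (0 : ℝ) 1})
    (hE₂ : E₂ ⊆ {x : EuclideanSpace ℝ (Fin d) | ∀ i, x i ∈ Set.Icc (0 : ℝ) 1})
    (μ₁ μ₂ : Measure (EuclideanSpace ℝ (Fin d)))
    [IsProbabilityMeasure μ₁] [IsProbabilityMeasure μ₂]
    (hsupp₁ : measSupport μ₁ ⊆ E₁) (hsupp₂ : measSupport μ₂ ⊆ E₂)
    (C₀ : ℝ) (hC₀ : 0 < C₀)
    (hfrost₁ : ∀ (x : EuclideanSpace ℝ (Fin d)) (r : ℝ), 0 < r →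
      μ₁ (ball x r) ≤ ENNReal.ofReal (C₀ * r ^ s))
    (hfrost₂ : ∀ (x : EuclideanSpace ℝ (Fin d)) (r : ℝ), 0 < r →
      μ₂ (ball x r) ≤ ENNReal.ofReal (C₀ * r ^ s))
    (hsep : ∀ x ∈ measSupport μ₁, ∀ y ∈ measSupport μ₂,
      c ≤ |x ⟨d - 1, by omega⟩ - y ⟨d - 1, by omega⟩|) :
    0 < μH[((d : ℝ) - 1)] {ω : EuclideanSpace ℝ (Fin d) |
      ∃ x ∈ measSupport μ₁, ∃ y ∈ measSupport μ₂, ω = ‖x - y‖⁻¹ • (x - y)} := by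
  obtain ⟨n, rfl⟩ : ∃ n, d = n + 1 := ⟨d - 1, by omega⟩
  have hlast : ∀ h : n + 1 - 1 < n + 1, (⟨n + 1 - 1, h⟩ : Fin (n+1)) = Fin.last n := fun _ => rfl
  simp only [hlast] at hsep
  have hn : (((n + 1 : ℕ) : ℝ) - 1) = n := by push_cast; ring
  rw [hn] at hs ⊢
  have hI₁ : ∀ x ∈ measSupport μ₁, ∀ i, x i ∈ Set.Icc (0 : ℝ) 1 := fun x hx => hE₁ (hsupp₁ hx)
  have hI₂ : ∀ x ∈ measSupport μ₂, ∀ i, x i ∈ Set.Icc (0 : ℝ) 1 := fun x hx => hE₂ (hsupp₂ hx)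
  have hle : ∀ x ∈ measSupport μ₁, ∀ y ∈ measSupport μ₂, ∀ i, |x i - y i| ≤ 1 := by
    intro x hx y hy i
    have a := hI₁ x hx i
    have b := hI₂ y hy i
    rw [abs_le]; constructor <;> linarith [a.1, a.2, b.1, b.2]
  have hne : ∀ x ∈ measSupport μ₁, ∀ y ∈ measSupport μ₂,
      x (Fin.last n) - y (Fin.last n) ≠ 0 := fun x hx y hy =>
    abs_pos.1 (hc.trans_le (hsep x hx y hy))
  rw [pos_iff_ne_zero]
  intro hzero
  set Dir := {ω : EuclideanSpace ℝ (Fin (n+1)) |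
      ∃ x ∈ measSupport μ₁, ∃ y ∈ measSupport μ₂, ω = ‖x - y‖⁻¹ • (x - y)} with hDir
  set D : Set (Fin n → ℝ) := slp '' (measSupport μ₁ ×ˢ measSupport μ₂) with hD
  have hDc : IsCompact D := by
    refine ((supp_compact μ₁ hI₁).prod (supp_compact μ₂ hI₂)).image_of_continuousOn ?_
    unfold slp
    rw [continuousOn_pi]
    intro i
    apply ContinuousOn.div
    · fun_prop
    · fun_prop
    · rintro ⟨x, y⟩ ⟨hx, hy⟩
      exact hne x hx y hy
  have hDR : D ⊆ closedBall 0 (1/c) := by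
    rintro _ ⟨⟨x, y⟩, ⟨hx, hy⟩, rfl⟩
    rw [mem_closedBall_zero_iff, pi_norm_le_iff_of_nonneg (by positivity)]
    intro i
    simp only [slp, norm_div, Real.norm_eq_abs]
    gcongr
    · exact hle x hx y hy _
    · exact hsep x hx y hy
  have hc' : 0 < c / (n+1) := by positivity
  have hsub : Dir ⊆ {ω | ‖ω‖ ≤ 1 ∧ c / (n+1) ≤ |ω (Fin.last n)|} := by
    rintro _ ⟨x, hx, y, hy, rfl⟩
    have hxy : x - y ≠ 0 := by
      intro h
      apply hne x hx y hy
      rw [← PiLp.sub_apply, h]; rfl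
    have hpos : 0 < ‖x - y‖ := norm_pos_iff.2 hxy
    refine ⟨?_, ?_⟩
    · rw [norm_smul, norm_inv, norm_norm, inv_mul_cancel₀ hpos.ne']
    · have hN := norm_le_coord (x - y) 1 zero_le_one (fun i => hle x hx y hy i)
      push_cast at hN
      rw [PiLp.smul_apply, smul_eq_mul, abs_mul, abs_inv, abs_norm, PiLp.sub_apply,
        inv_mul_eq_div]
      have := hsep x hx y hy
      gcongr
      linarith
  have himg : D ⊆ gno '' Dir := by
    rintro _ ⟨⟨x, y⟩, ⟨hx, hy⟩, rfl⟩
    refine ⟨_, ⟨x, hx, y, hy, rfl⟩, ?_⟩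
    have h := hne x hx y hy
    have hxy : x - y ≠ 0 := by
      intro h'
      apply h
      rw [← PiLp.sub_apply, h']; rfl
    have hpos : ‖x - y‖ ≠ 0 := norm_ne_zero_iff.2 hxy
    ext i
    simp only [gno, slp, PiLp.smul_apply, PiLp.sub_apply, smul_eq_mul]
    field_simp
  have hvol : volume D = 0 := by
    have h1 := ((gno_lip (n := n) _ hc').mono hsub).hausdorffMeasure_image_le (d := (n:ℝ)) (by positivity)
    rw [hzero, mul_zero] at h1
    have h2 := hausdorffMeasure_pi_real (ι := Fin n)
    rw [Fintype.card_fin] at h2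
    rw [← h2]
    exact le_antisymm ((measure_mono himg).trans h1) bot_le
  exact core s C₀ (1/c) hs hC₀ (by positivity) μ₁ μ₂ hfrost₁ hfrost₂ _ _ (supp_null μ₁) (supp_null μ₂)
    D hDc hDR hne (fun x hx y hy => hle x hx y hy _)
    (fun x hx y hy => ⟨(x, y), ⟨hx, hy⟩, rfl⟩) hvol
end

section
/- Let d ≥ 2, let P ⊆ ℝ^d be a finite δ-separated set for some δ > 0, and let 0 < r ≤ δ/4. Then the set of all directions (x−y)/‖x−y‖, where x lies in the closed ball of radius r about some p ∈ P, y lies in the closed ball of radius r about some q ∈ P, and p ≠ q, is contained in the union over ω ∈ 𝒟(P) of the closed balls of radius 4r/δ centered at ω; consequently, this set of directions has (d−1)-dimensional Hausdorff measure at most C_d · #𝒟(P) · (r/δ)^{d−1}, where C_d is a constant depending only on d. -/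
open MeasureTheory Metric

/-- The set of directions determined by a set `A ⊆ ℝ^d`. -/
def directionSet {d : ℕ} (A : Set (EuclideanSpace ℝ (Fin d))) :
    Set (EuclideanSpace ℝ (Fin d)) :=
  {ω | ∃ x ∈ A, ∃ y ∈ A, x ≠ y ∧ ω = ‖x - y‖⁻¹ • (x - y)}

theorem tdc_unit_diff {E : Type*} [NormedAddCommGroup E] [NormedSpace ℝ E] (u v : E)
    (hu : u ≠ 0) (hv : v ≠ 0) :
    ‖‖u‖⁻¹ • u - ‖v‖⁻¹ • v‖ ≤ 2 * ‖u - v‖ / ‖v‖ := by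
  have hu' : 0 < ‖u‖ := norm_pos_iff.2 hu
  have hv' : 0 < ‖v‖ := norm_pos_iff.2 hv
  rw [le_div_iff₀ hv']
  have h1 : ‖‖u‖⁻¹ • u - ‖v‖⁻¹ • v‖ * ‖v‖ = ‖(‖v‖ - ‖u‖) • (‖u‖⁻¹ • u) + (u - v)‖ := by
    have : (‖v‖ - ‖u‖) • (‖u‖⁻¹ • u) + (u - v) = ‖v‖ • (‖u‖⁻¹ • u - ‖v‖⁻¹ • v) := by
      rw [sub_smul, smul_inv_smul₀ hu'.ne', smul_sub, smul_inv_smul₀ hv'.ne']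
      abel
    rw [this, norm_smul, norm_norm, mul_comm]
  rw [h1]
  refine (norm_add_le _ _).trans ?_
  have h2 : ‖(‖v‖ - ‖u‖) • (‖u‖⁻¹ • u)‖ ≤ ‖u - v‖ := by
    rw [norm_smul, norm_smul, norm_inv, norm_norm, inv_mul_cancel₀ hu'.ne', mul_one,
      norm_sub_rev u v]
    exact abs_norm_sub_norm_le _ _
  linarith

theorem tdc_anti {E : Type*} [NormedAddCommGroup E] [InnerProductSpace ℝ E] (ω x y : E)
    (hω : ‖ω‖ = 1) (hx : ‖x‖ = 1) (hy : ‖y‖ = 1) (hxω : ‖x - ω‖ ≤ 1) (hyω : ‖y - ω‖ ≤ 1) :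
    (inner ℝ ω (x - y)) ^ 2 ≤ 3 / 4 * ‖x - y‖ ^ 2 := by
  have h1 := norm_sub_sq_real x ω
  have h2 := norm_sub_sq_real y ω
  rw [hω, hx] at h1
  rw [hω, hy] at h2
  have h1' : ‖x - ω‖ ^ 2 ≤ 1 := by nlinarith [norm_nonneg (x - ω)]
  have h2' : ‖y - ω‖ ^ 2 ≤ 1 := by nlinarith [norm_nonneg (y - ω)]
  have horth : inner ℝ (x + y) (x - y) = (0 : ℝ) := by
    rw [real_inner_add_sub_eq_zero_iff]; rw [hx, hy]
  have hs : inner ℝ ω (x - y) = inner ℝ (ω - (1 / 4 : ℝ) • (x + y)) (x - y) := by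
    rw [inner_sub_left, inner_smul_left, horth]; simp
  have hn : ‖ω - (1 / 4 : ℝ) • (x + y)‖ ^ 2 ≤ 3 / 4 := by
    rw [norm_sub_sq_real, inner_smul_right, inner_add_right, norm_smul, hω,
      real_inner_comm, real_inner_comm y ω]
    have h3 : ‖x + y‖ ≤ 2 := by
      have := norm_add_le x y
      rw [hx, hy] at this; linarith
    have h4 : ‖x + y‖ ^ 2 ≤ 4 := by nlinarith [norm_nonneg (x + y)]
    rw [mul_pow, show ‖(1 / 4 : ℝ)‖ = 1 / 4 by norm_num]
    nlinarith
  rw [hs]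
  have hcs := abs_real_inner_le_norm (ω - (1 / 4 : ℝ) • (x + y)) (x - y)
  calc _ = |inner ℝ (ω - (1 / 4 : ℝ) • (x + y)) (x - y)| ^ 2 := (sq_abs _).symm
    _ ≤ (‖ω - (1 / 4 : ℝ) • (x + y)‖ * ‖x - y‖) ^ 2 := by gcongr
    _ = ‖ω - (1 / 4 : ℝ) • (x + y)‖ ^ 2 * ‖x - y‖ ^ 2 := mul_pow _ _ _
    _ ≤ _ := by gcongr

theorem tdc_ball (n : ℕ) : ∃ C : ℝ, 0 < C ∧ ∀ ρ : ℝ, 0 ≤ ρ →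
    μH[(n : ℝ)] (closedBall (0 : EuclideanSpace ℝ (Fin n)) ρ) ≤ ENNReal.ofReal (C * ρ ^ n) := by
  obtain ⟨K, hK⟩ : ∃ K : NNReal, LipschitzWith K
      (WithLp.toLp 2 : (Fin n → ℝ) → EuclideanSpace ℝ (Fin n)) :=
    ⟨_, PiLp.lipschitzWith_toLp 2 (fun _ : Fin n => ℝ)⟩
  refine ⟨((K : ℝ) + 1) ^ n * 2 ^ n, by positivity, fun ρ hρ => ?_⟩
  have hsub : closedBall (0 : EuclideanSpace ℝ (Fin n)) ρ ⊆
      (WithLp.toLp 2 : (Fin n → ℝ) → EuclideanSpace ℝ (Fin n)) ''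
        closedBall (0 : Fin n → ℝ) ρ := by
    intro x hx
    refine ⟨WithLp.ofLp x, ?_, rfl⟩
    rw [mem_closedBall_zero_iff] at hx ⊢
    rw [pi_norm_le_iff_of_nonneg hρ]
    intro i
    exact (PiLp.norm_apply_le x i).trans hx
  have hvol : μH[(n : ℝ)] (closedBall (0 : Fin n → ℝ) ρ) = ENNReal.ofReal ((2 * ρ) ^ n) := by
    have := hausdorffMeasure_pi_real (ι := Fin n)
    rw [Fintype.card_fin] at this
    rw [this, Real.volume_pi_closedBall _ hρ, Fintype.card_fin]
  calc _ ≤ _ := measure_mono hsub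
    _ ≤ _ := hK.hausdorffMeasure_image_le (Nat.cast_nonneg n) _
    _ ≤ ENNReal.ofReal (((K : ℝ) + 1) ^ n) * ENNReal.ofReal ((2 * ρ) ^ n) := by
      rw [hvol, ENNReal.rpow_natCast, ENNReal.ofReal_pow (p := (K : ℝ) + 1) (by positivity)]
      gcongr
      rw [← ENNReal.ofReal_coe_nnreal]
      exact ENNReal.ofReal_le_ofReal (by linarith)
    _ = _ := by
      rw [← ENNReal.ofReal_mul (by positivity)]
      congr 1
      rw [mul_pow]; ring

theorem tdc_cap (n : ℕ) : ∃ C : ℝ, 0 < C ∧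
    ∀ (ω : EuclideanSpace ℝ (Fin (n + 1))) (ρ : ℝ), ‖ω‖ = 1 → 0 ≤ ρ → ρ ≤ 1 →
    μH[(n : ℝ)] (sphere (0 : EuclideanSpace ℝ (Fin (n + 1))) 1 ∩ closedBall ω ρ)
      ≤ ENNReal.ofReal (C * ρ ^ n) := by
  obtain ⟨C, hC, hball⟩ := tdc_ball n
  refine ⟨2 ^ n * C, by positivity, fun ω ρ hω hρ hρ1 => ?_⟩
  have hfact : Fact (Module.finrank ℝ (EuclideanSpace ℝ (Fin (n + 1))) = n + 1) := ⟨by simp⟩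
  have hω0 : ω ≠ 0 := by rintro rfl; simp at hω
  let b := OrthonormalBasis.fromOrthogonalSpanSingleton (𝕜 := ℝ) n hω0
  let f : EuclideanSpace ℝ (Fin (n + 1)) → EuclideanSpace ℝ (Fin n) :=
    fun x => b.repr (Submodule.orthogonalProjectionOnto (ℝ ∙ ω)ᗮ x)
  have hfsub : ∀ x y, f x - f y = f (x - y) := fun x y => by simp only [f, map_sub]
  have hfn : ∀ x, ‖f x‖ ^ 2 = ‖x‖ ^ 2 - (inner ℝ ω x) ^ 2 := by
    intro x
    have h := Submodule.norm_sq_eq_add_norm_sq_starProjection x (ℝ ∙ ω)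
    rw [Submodule.starProjection_unit_singleton ℝ hω, norm_smul, hω, mul_one,
      Real.norm_eq_abs, sq_abs] at h
    have h2 : ‖f x‖ = ‖Submodule.starProjection (ℝ ∙ ω)ᗮ x‖ := by
      simp only [f, LinearIsometryEquiv.norm_map]
      rfl
    rw [h2]; linarith
  set A := sphere (0 : EuclideanSpace ℝ (Fin (n + 1))) 1 ∩ closedBall ω ρ with hA
  have hanti : ∀ x ∈ A, ∀ y ∈ A, ‖x - y‖ ≤ 2 * ‖f x - f y‖ := by
    rintro x ⟨hx1, hx2⟩ y ⟨hy1, hy2⟩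
    rw [mem_sphere_zero_iff_norm] at hx1 hy1
    rw [mem_closedBall_iff_norm] at hx2 hy2
    have h := tdc_anti ω x y hω hx1 hy1 (hx2.trans hρ1) (hy2.trans hρ1)
    have h2 := hfn (x - y)
    rw [hfsub]
    refine abs_le_of_sq_le_sq' ?_ (by positivity) |>.2
    nlinarith
  have hinj : Set.InjOn f A := by
    intro x hx y hy hxy
    have := hanti x hx y hy
    rw [hxy, sub_self, norm_zero, mul_zero] at this
    exact sub_eq_zero.1 (norm_le_zero_iff.1 this)
  let g := Function.invFunOn f A
  have hg : ∀ x ∈ A, g (f x) = x := fun x hx => hinj.leftInvOn_invFunOn hx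
  have hgl : LipschitzOnWith 2 g (f '' A) := by
    refine LipschitzOnWith.of_dist_le_mul ?_
    rintro _ ⟨x, hx, rfl⟩ _ ⟨y, hy, rfl⟩
    rw [hg x hx, hg y hy, dist_eq_norm, dist_eq_norm]
    exact hanti x hx y hy
  have hAsub : A ⊆ g '' (f '' A) := fun x hx => ⟨f x, ⟨x, hx, rfl⟩, hg x hx⟩
  have hfA : f '' A ⊆ closedBall 0 ρ := by
    rintro _ ⟨x, ⟨-, hx⟩, rfl⟩
    rw [mem_closedBall_zero_iff]
    rw [mem_closedBall_iff_norm] at hx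
    have h0 : f ω = 0 := by
      have h := hfn ω
      rw [real_inner_self_eq_norm_sq, hω] at h
      norm_num at h
      exact h
    have h1 := hfn (x - ω)
    rw [← hfsub, h0, sub_zero] at h1
    have h2 : ‖f x‖ ≤ ‖x - ω‖ := by
      refine abs_le_of_sq_le_sq' ?_ (by positivity) |>.2
      nlinarith [sq_nonneg (inner ℝ ω (x - ω))]
    exact h2.trans hx
  calc _ ≤ _ := measure_mono hAsub
    _ ≤ _ := hgl.hausdorffMeasure_image_le (Nat.cast_nonneg n)
    _ ≤ ENNReal.ofReal (2 ^ n) * ENNReal.ofReal (C * ρ ^ n) := by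
      gcongr
      · rw [ENNReal.rpow_natCast, ENNReal.ofReal_pow (by positivity)]
        simp
      · exact (measure_mono hfA).trans (hball ρ hρ)
    _ = _ := by
      rw [← ENNReal.ofReal_mul (by positivity), mul_assoc]

theorem thickened_directions_cover (d : ℕ) (hd : 2 ≤ d) :
    ∃ C : ℝ, 0 < C ∧
      ∀ (P : Finset (EuclideanSpace ℝ (Fin d))) (δ r : ℝ), 0 < δ → 0 < r → r ≤ δ / 4 →
        (∀ p ∈ P, ∀ q ∈ P, p ≠ q → δ ≤ ‖p - q‖) →
        ({ω : EuclideanSpace ℝ (Fin d) | ∃ p ∈ P, ∃ q ∈ P, p ≠ q ∧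
            ∃ x ∈ closedBall p r, ∃ y ∈ closedBall q r, ω = ‖x - y‖⁻¹ • (x - y)}
          ⊆ ⋃ ω ∈ directionSet (P : Set (EuclideanSpace ℝ (Fin d))),
              closedBall ω (4 * r / δ)) ∧
        μH[((d : ℝ) - 1)] {ω : EuclideanSpace ℝ (Fin d) | ∃ p ∈ P, ∃ q ∈ P, p ≠ q ∧
            ∃ x ∈ closedBall p r, ∃ y ∈ closedBall q r, ω = ‖x - y‖⁻¹ • (x - y)}
          ≤ ENNReal.ofReal (C * (directionSet (P : Set (EuclideanSpace ℝ (Fin d)))).ncard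
              * (r / δ) ^ (d - 1)) := by
  obtain ⟨n, rfl⟩ : ∃ n, d = n + 1 := ⟨d - 1, by omega⟩
  obtain ⟨C, hC, hcap⟩ := tdc_cap n
  refine ⟨C * 4 ^ n, by positivity, fun P δ r hδ hr hrδ hsep => ?_⟩
  have key : ∀ p ∈ P, ∀ q ∈ P, p ≠ q → ∀ x ∈ closedBall p r, ∀ y ∈ closedBall q r,
      x - y ≠ 0 ∧ ‖‖x - y‖⁻¹ • (x - y) - ‖p - q‖⁻¹ • (p - q)‖ ≤ 4 * r / δ := by
    intro p hp q hq hpq x hx y hy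
    have h1 := hsep p hp q hq hpq
    rw [mem_closedBall_iff_norm] at hx hy
    have h2 : ‖(x - y) - (p - q)‖ ≤ 2 * r := by
      rw [show (x - y) - (p - q) = (x - p) - (y - q) by abel]
      linarith [norm_sub_le (x - p) (y - q)]
    have hu : x - y ≠ 0 := by
      intro h
      rw [h, zero_sub, norm_neg] at h2
      linarith
    refine ⟨hu, (tdc_unit_diff _ _ hu (sub_ne_zero.2 hpq)).trans ?_⟩
    apply div_le_div₀ <;> linarith
  set D := directionSet (P : Set (EuclideanSpace ℝ (Fin (n + 1)))) with hD
  set S := {ω : EuclideanSpace ℝ (Fin (n + 1)) | ∃ p ∈ P, ∃ q ∈ P, p ≠ q ∧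
            ∃ x ∈ closedBall p r, ∃ y ∈ closedBall q r, ω = ‖x - y‖⁻¹ • (x - y)} with hS
  have hcover : S ⊆ ⋃ ω ∈ D, closedBall ω (4 * r / δ) := by
    rintro ω ⟨p, hp, q, hq, hpq, x, hx, y, hy, rfl⟩
    refine Set.mem_biUnion (x := ‖p - q‖⁻¹ • (p - q)) ⟨p, hp, q, hq, hpq, rfl⟩ ?_
    rw [mem_closedBall_iff_norm]
    exact (key p hp q hq hpq x hx y hy).2
  refine ⟨hcover, ?_⟩
  have hDfin : D.Finite := by
    refine ((P.finite_toSet.prod P.finite_toSet).image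
      (fun z => ‖z.1 - z.2‖⁻¹ • (z.1 - z.2))).subset ?_
    rintro ω ⟨p, hp, q, hq, -, rfl⟩
    exact ⟨(p, q), ⟨hp, hq⟩, rfl⟩
  have hDnorm : ∀ ω ∈ D, ‖ω‖ = 1 := by
    rintro ω ⟨p, hp, q, hq, hpq, rfl⟩
    exact norm_smul_inv_norm (𝕜 := ℝ) (sub_ne_zero.2 hpq)
  have hSsub : S ⊆ ⋃ ω ∈ hDfin.toFinset, (sphere 0 1 ∩ closedBall ω (4 * r / δ)) := by
    intro ω hω
    have h := hcover hω
    obtain ⟨p, hp, q, hq, hpq, x, hx, y, hy, rfl⟩ := hω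
    simp only [Set.mem_iUnion, exists_prop, Set.Finite.mem_toFinset] at h ⊢
    obtain ⟨i, hi, hb⟩ := h
    refine ⟨i, hi, ?_, hb⟩
    rw [mem_sphere_zero_iff_norm]
    exact norm_smul_inv_norm (𝕜 := ℝ) (key p hp q hq hpq x hx y hy).1
  have hexp : (((n + 1 : ℕ) : ℝ) - 1) = n := by push_cast; ring
  rw [hexp]
  have hρ1 : 4 * r / δ ≤ 1 := by rw [div_le_one hδ]; linarith
  calc _ ≤ _ := measure_mono hSsub
    _ ≤ _ := measure_biUnion_finset_le _ _
    _ ≤ ∑ ω ∈ hDfin.toFinset, ENNReal.ofReal (C * (4 * r / δ) ^ n) := by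
      refine Finset.sum_le_sum fun ω hω => hcap ω _ (hDnorm ω ?_) (by positivity) hρ1
      exact hDfin.mem_toFinset.1 hω
    _ = _ := by
      rw [Finset.sum_const, Set.ncard_eq_toFinset_card D hDfin, nsmul_eq_mul,
        ← ENNReal.ofReal_natCast, ← ENNReal.ofReal_mul (by positivity)]
      congr 1
      rw [Nat.add_sub_cancel, mul_div_assoc, mul_pow]
      ring
end
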